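/- arXiv:2111.13263 — 9 statements merged into one kernel-verified Lean document; each statement's English description precedes it below -/
import Mathlib

section
/- Let d ≥ 1 and n ≥ 1 be integers and let 0 < q ≤ r be real numbers. Let B₁, …, Bₙ be closed Euclidean balls of radius q in ℝᵈ (i.e. Bⱼ = closedBall(cⱼ, q) for centers cⱼ), each contained in a fixed closed ball B = closedBall(c, r). Then there exists a point y ∈ B such that the number of indices j ∈ {1, …, n} with y ∈ Bⱼ is at least n · qᵈ / rᵈ. (Equivalently, max_{y ∈ B} |{j : y ∈ Bⱼ}| ≥ n · Vol(B₁)/Vol(B) = n qᵈ/rᵈ.) -/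
open Metric

/-- Ball pigeonhole lemma (Lemma 3.3): given `n` closed balls of radius `q` in `ℝᵈ`,
each contained in a fixed closed ball of radius `r`, some point of the big ball lies in
at least `n·qᵈ/rᵈ` of the small balls. -/
theorem ball_pigeonhole
    (d n : ℕ) (hd : 1 ≤ d) (hn : 1 ≤ n)
    (q r : ℝ) (hq : 0 < q) (hqr : q ≤ r)
    (c : Fin n → EuclideanSpace ℝ (Fin d)) (c₀ : EuclideanSpace ℝ (Fin d))
    (hsub : ∀ j, closedBall (c j) q ⊆ closedBall c₀ r) :
    ∃ y ∈ closedBall c₀ r,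
      (n : ℝ) * q ^ d / r ^ d ≤ ({j : Fin n | y ∈ closedBall (c j) q}).ncard := by
  classical
  have hr : 0 < r := hq.trans_le hqr
  let f : EuclideanSpace ℝ (Fin d) → ℝ :=
    fun y => ∑ j, (closedBall (c j) q).indicator (fun _ => (1 : ℝ)) y
  have hfin : ∀ (x : EuclideanSpace ℝ (Fin d)) (s : ℝ),
      MeasureTheory.volume (closedBall x s) ≠ ⊤ := fun x s =>
    MeasureTheory.measure_closedBall_lt_top.ne
  have hint : ∀ j ∈ (Finset.univ : Finset (Fin n)), MeasureTheory.IntegrableOn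
      ((closedBall (c j) q).indicator (fun _ => (1 : ℝ))) (closedBall c₀ r)
      MeasureTheory.volume := by
    intro j _
    exact (MeasureTheory.integrableOn_const (hfin c₀ r)).indicator
      isClosed_closedBall.measurableSet
  have hf : MeasureTheory.IntegrableOn f (closedBall c₀ r) MeasureTheory.volume :=
    MeasureTheory.integrable_finset_sum _ hint
  obtain ⟨y, hy, h⟩ := MeasureTheory.exists_setAverage_le
    (measure_closedBall_pos MeasureTheory.volume c₀ hr).ne' (hfin c₀ r) hf
  refine ⟨y, hy, ?_⟩
  have hfy : f y = ({j : Fin n | y ∈ closedBall (c j) q}).ncard := by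
    simp only [f, Set.indicator_apply, Finset.sum_boole]
    rw [Set.ncard_eq_toFinset_card']
    congr 2
    ext j
    simp
  have hI : ∫ a in closedBall c₀ r, f a =
      n * MeasureTheory.volume.real (closedBall (0 : EuclideanSpace ℝ (Fin d)) 1) * q ^ d := by
    have h1 : ∀ j, ∫ a in closedBall c₀ r, (closedBall (c j) q).indicator (fun _ => (1 : ℝ)) a =
        q ^ d * MeasureTheory.volume.real (closedBall (0 : EuclideanSpace ℝ (Fin d)) 1) := by
      intro j
      rw [MeasureTheory.setIntegral_indicator isClosed_closedBall.measurableSet,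
        Set.inter_eq_right.mpr (hsub j), MeasureTheory.setIntegral_const,
        MeasureTheory.Measure.addHaar_real_closedBall' _ _ hq.le]
      simp
    rw [MeasureTheory.integral_finset_sum _ hint]
    simp only [h1, Finset.sum_const, Finset.card_univ, Fintype.card_fin, nsmul_eq_mul]
    ring
  have hv : 0 < MeasureTheory.volume.real (closedBall (0 : EuclideanSpace ℝ (Fin d)) 1) :=
    ENNReal.toReal_pos (measure_closedBall_pos _ _ one_pos).ne' (hfin _ _)
  rw [MeasureTheory.setAverage_eq, hI, hfy,
    MeasureTheory.Measure.addHaar_real_closedBall' _ _ hr.le, finrank_euclideanSpace_fin] at h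
  refine le_of_eq_of_le ?_ h
  rw [smul_eq_mul]
  field_simp
end

section
/- For all real numbers s ≥ 0 and a ≥ 0: if cosh(a) ≥ cosh(s)² − sinh(s)² · cos(exp(1 − (2/3)·s)), then a ≥ (2/3)·s. -/
open Real

lemma sin_key (y : ℝ) (hy : 0 < y) (hy1 : y ≤ 1) :
    y ≤ Real.sin (Real.exp 1 * y / 2) * (y ^ 2 + y + 1) := by
  have e1 := Real.exp_one_gt_d9
  have e2 := Real.exp_one_lt_d9
  have p2 := Real.pi_lt_d2
  have p1 := Real.pi_gt_three
  set t := Real.exp 1 * y / 2 with ht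
  have t1 : 1.359 * y ≤ t := by rw [ht]; nlinarith
  have t2 : t ≤ 1.36 * y := by rw [ht]; nlinarith
  have t0 : 0 < t := by linarith
  have hq : 1 ≤ y ^ 2 + y + 1 := by nlinarith
  rcases le_or_gt y (0.7 : ℝ) with h | h
  · have hs := Real.sin_gt_sub_cube t0
    have h2 : t ^ 2 ≤ 1.85 * y ^ 2 := by nlinarith
    have h3 : y * (1.359 * (1 - 0.4625 * y ^ 2)) ≤ Real.sin t := by
      have : t * (1 - t ^ 2 / 4) ≤ Real.sin t := by nlinarith [pow_pos t0 3]
      have h5 : 1.359 * y * (1 - 0.4625 * y ^ 2) ≤ t * (1 - t ^ 2 / 4) := by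
        apply mul_le_mul t1 (by linarith) (by nlinarith) t0.le
      linarith
    have h6 : 1 ≤ (1.359 * (1 - 0.4625 * y ^ 2)) * (y ^ 2 + y + 1) := by
      have : y ^ 2 ≤ 0.49 := by nlinarith
      nlinarith
    calc y = y * 1 := by ring
      _ ≤ y * ((1.359 * (1 - 0.4625 * y ^ 2)) * (y ^ 2 + y + 1)) := by gcongr
      _ = (y * (1.359 * (1 - 0.4625 * y ^ 2))) * (y ^ 2 + y + 1) := by ring
      _ ≤ _ := by gcongr
  · have hs := Real.mul_le_sin t0.le (by linarith)
    have h3 : 0.6 * t ≤ Real.sin t := by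
      refine le_trans ?_ hs
      gcongr
      rw [le_div_iff₀ (by positivity)]; linarith
    have : 0.8 * y ≤ Real.sin t := by linarith
    nlinarith

theorem geodesics_diverge_analytic (s a : ℝ) (hs : 0 ≤ s) (ha : 0 ≤ a)
    (h : Real.cosh a ≥ Real.cosh s ^ 2 - Real.sinh s ^ 2 * Real.cos (Real.exp (1 - 2 / 3 * s))) :
    a ≥ 2 / 3 * s := by
  obtain ⟨u, rfl⟩ : ∃ u, s = 3 * u := ⟨s / 3, by ring⟩
  have hu : 0 ≤ u := by linarith
  have hx : 1 ≤ Real.exp u := Real.one_le_exp hu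
  have hxy : Real.exp u * Real.exp (-u) = 1 := by rw [← Real.exp_add]; simp
  have hz : 0 < Real.exp (-u) := Real.exp_pos _
  have hz1 : Real.exp (-u) ≤ 1 := Real.exp_le_one_iff.2 (by linarith)
  have key := sin_key (Real.exp (-u) ^ 2) (by positivity) (by nlinarith)
  have hth : Real.exp (1 - 2 / 3 * (3 * u)) = 2 * (Real.exp 1 * Real.exp (-u) ^ 2 / 2) := by
    rw [← Real.exp_nat_mul, mul_div_cancel₀ _ (by norm_num), ← Real.exp_add]
    congr 1; push_cast; ring
  rw [hth, Real.cos_two_mul, Real.cos_sq', Real.sinh_three_mul, Real.cosh_sq, Real.sinh_three_mul] at h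
  set S := Real.sin (Real.exp 1 * Real.exp (-u) ^ 2 / 2) with hS
  have hw : 0 ≤ Real.sinh u := Real.sinh_nonneg_iff.2 hu
  have k2 : 1 ≤ S * (4 * Real.sinh u ^ 2 + 3) := by
    rw [Real.sinh_eq]
    have : Real.exp u ^ 2 * Real.exp (-u) ^ 2 = 1 := by rw [← mul_pow, hxy, one_pow]
    have k := mul_le_mul_of_nonneg_left key (sq_nonneg (Real.exp u))
    rw [this] at k
    refine k.trans (le_of_eq ?_)
    have e : Real.exp u ^ 2 * ((Real.exp (-u) ^ 2) ^ 2 + Real.exp (-u) ^ 2 + 1)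
      = 4 * ((Real.exp u - Real.exp (-u)) / 2) ^ 2 + 3 := by
      linear_combination (Real.exp (-u) ^ 2 + 1) * this + 2 * hxy
    linear_combination S * e
  have k3 : 1 ≤ (S * (4 * Real.sinh u ^ 2 + 3)) ^ 2 := by nlinarith
  have k4 : Real.cosh (2 * u) ≤ Real.cosh a := by
    rw [Real.cosh_two_mul, Real.cosh_sq]
    nlinarith [mul_le_mul_of_nonneg_left k3 (sq_nonneg (Real.sinh u))]
  rw [Real.cosh_le_cosh, abs_of_nonneg ha, abs_of_nonneg (by linarith)] at k4
  linarith
end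

section
/- For every real t > 0: exp(1 − (2/3)·t) ≥ sqrt( 3 · ( 1 − (cosh(t)² − cosh(2t/3)) / sinh(t)² ) ). Equivalently, sinh(t)² · (1 − exp(2 − (4/3)t)/3) ≤ cosh(t)² − cosh(2t/3) for all t ≥ 0. -/
open Real

theorem appendix_B1_key (t : ℝ) :
    Real.cosh (2 * t / 3) - 1 ≤ Real.sinh t ^ 2 * (Real.exp (2 - 4 / 3 * t) / 3) := by
  have hxz : Real.exp (t / 3) * Real.exp (-(t / 3)) = 1 := by
    rw [← Real.exp_add]; simp
  have h1 : Real.cosh (2 * t / 3) = (Real.exp (t / 3) ^ 2 + Real.exp (-(t / 3)) ^ 2) / 2 := by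
    rw [Real.cosh_eq, ← Real.exp_nat_mul, ← Real.exp_nat_mul]
    congr 3 <;> · push_cast; ring
  have h2 : Real.sinh t = (Real.exp (t / 3) ^ 3 - Real.exp (-(t / 3)) ^ 3) / 2 := by
    rw [Real.sinh_eq, ← Real.exp_nat_mul, ← Real.exp_nat_mul]
    congr 3 <;> · push_cast; ring
  have h3 : Real.exp (2 - 4 / 3 * t) = Real.exp 1 ^ 2 * Real.exp (-(t / 3)) ^ 4 := by
    rw [← Real.exp_nat_mul, ← Real.exp_nat_mul, ← Real.exp_add]
    congr 1; push_cast; ring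
  have hE : 6 ≤ Real.exp 1 ^ 2 := by
    have := Real.exp_one_gt_d9
    nlinarith
  rw [h1, h2, h3]
  generalize Real.exp (t / 3) = x at *
  generalize Real.exp (-(t / 3)) = z at *
  generalize Real.exp 1 ^ 2 = E at *
  have hw : (x ^ 3 - z ^ 3) * z ^ 2 = (x - z) * (1 + z ^ 2 + z ^ 4) := by
    linear_combination (x - z) * (x * z + 1 + z ^ 2) * hxz
  have e1 : ((x ^ 3 - z ^ 3) / 2) ^ 2 * (E * z ^ 4 / 3)
      = (x - z) ^ 2 * ((1 + z ^ 2 + z ^ 4) ^ 2 * E) / 12 := by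
    have : ((x ^ 3 - z ^ 3) / 2) ^ 2 * (E * z ^ 4 / 3)
      = ((x ^ 3 - z ^ 3) * z ^ 2) ^ 2 * E / 12 := by ring
    rw [this, hw]; ring
  have e2 : (x ^ 2 + z ^ 2) / 2 - 1 = (x - z) ^ 2 * 6 / 12 := by
    linear_combination hxz
  have hw1 : 1 ≤ (1 + z ^ 2 + z ^ 4) ^ 2 := by
    apply one_le_pow₀
    have : 0 ≤ z ^ 2 + z ^ 4 := by positivity
    linarith
  have h6 : 6 ≤ (1 + z ^ 2 + z ^ 4) ^ 2 * E := by nlinarith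
  rw [e1, e2]
  gcongr

/-- The explicit analytic inequality of Appendix B.1 used to prove Lemma 2.2
(geodesics diverge): for all `t > 0`,
`e^{1 − (2/3)t} ≥ √(3(1 − (cosh² t − cosh(2t/3))/sinh² t))`, and equivalently
`sinh² t (1 − e^{2 − (4/3)t}/3) ≤ cosh² t − cosh(2t/3)` for all `t ≥ 0`. -/
theorem appendix_B1_inequality :
    (∀ t : ℝ, 0 < t →
      Real.exp (1 - 2 / 3 * t) ≥
        Real.sqrt (3 * (1 - (Real.cosh t ^ 2 - Real.cosh (2 * t / 3)) / Real.sinh t ^ 2))) ∧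
    (∀ t : ℝ, 0 ≤ t →
      Real.sinh t ^ 2 * (1 - Real.exp (2 - 4 / 3 * t) / 3) ≤
        Real.cosh t ^ 2 - Real.cosh (2 * t / 3)) := by
  refine ⟨fun t ht => ?_, fun t _ => ?_⟩
  · have hs : 0 < Real.sinh t ^ 2 := pow_pos (Real.sinh_pos_iff.mpr ht) 2
    have hk := appendix_B1_key t
    have hc := Real.cosh_sq t
    have he : Real.exp (1 - 2 / 3 * t) ^ 2 = Real.exp (2 - 4 / 3 * t) := by
      rw [← Real.exp_nat_mul]; congr 1; push_cast; ring
    apply Real.sqrt_le_iff.mpr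
    refine ⟨(Real.exp_pos _).le, ?_⟩
    rw [he]
    have : 1 - Real.exp (2 - 4 / 3 * t) / 3
        ≤ (Real.cosh t ^ 2 - Real.cosh (2 * t / 3)) / Real.sinh t ^ 2 := by
      rw [le_div_iff₀ hs]
      linarith
    linarith
  · have hk := appendix_B1_key t
    have hc := Real.cosh_sq t
    linarith
end

section
/- Let t : ℝ → ℝ be defined by t(τ) = exp(−1/(1−τ)) / (exp(−1/(1−τ)) + exp(−1/τ)). Then for every τ ∈ (0, 1/2) and every real c ≥ 9: 1 − t(τ) − (1/c)·|t′(τ)| ≥ −2·exp(−sqrt(c/2)), where t′(τ) denotes the derivative of t at τ. -/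
open Real

theorem cutoff_aux_exp (w s : ℝ) (hw : 0 < w) (hs : 0 < s) (hs2 : 9 / 2 ≤ s ^ 2) :
    8 + 3 / 2 * w ^ 2 ≤ 2 * s ^ 2 + 4 * s ^ 2 * Real.exp (w - s) := by
  have hs3 : (21 / 10 : ℝ) ≤ s := by nlinarith
  rcases le_total s w with h | h
  · obtain ⟨d, rfl⟩ : ∃ d, w = s + d := ⟨w - s, by ring⟩
    have hd : 0 ≤ d := by linarith
    have he : 1 + d + d ^ 2 / 2 ≤ Real.exp (s + d - s) := by
      rw [add_sub_cancel_left]; exact Real.quadratic_le_exp_of_nonneg hd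
    have h1 : 4 * s ^ 2 * (1 + d + d ^ 2 / 2) ≤ 4 * s ^ 2 * Real.exp (s + d - s) := by gcongr
    have h2 : 0 ≤ s * d * (s - 1) := by
      apply mul_nonneg <;> [positivity; linarith]
    have h3 : 0 ≤ (s ^ 2 - 9 / 2) * d ^ 2 := by
      apply mul_nonneg <;> [linarith; positivity]
    have h4 : 0 ≤ s * d := by positivity
    nlinarith
  · obtain ⟨d, rfl⟩ : ∃ d, w = s - d := ⟨s - w, by ring⟩
    have hd : 0 ≤ d := by linarith
    rcases le_total 2 d with h2 | h2
    · have : 0 ≤ 4 * s ^ 2 * Real.exp (s - d - s) := by positivity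
      have h5 : (s - d) ^ 2 ≤ (s - 2) ^ 2 := by
        apply pow_le_pow_left₀ hw.le; linarith
      nlinarith
    · have he : (1 - d / 2) ^ 2 ≤ Real.exp (s - d - s) := by
        have e1 : Real.exp (s - d - s) = Real.exp (-(d / 2)) ^ 2 := by
          rw [← Real.exp_nat_mul]; congr 1; push_cast; ring
        rw [e1]
        apply pow_le_pow_left₀ (by linarith)
        linarith [Real.add_one_le_exp (-(d / 2))]
      have h1 : 4 * s ^ 2 * (1 - d / 2) ^ 2 ≤ 4 * s ^ 2 * Real.exp (s - d - s) := by gcongr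
      have h3 : 0 ≤ (s ^ 2 - 9 / 2) * (1 / 2 + (2 - d) ^ 2) := by
        apply mul_nonneg <;> [linarith; positivity]
      have h4 : 0 ≤ (s - 21 / 10) * d := by
        apply mul_nonneg <;> linarith
      nlinarith [sq_nonneg (d - 2)]

theorem cutoff_lower_bound
    (t : ℝ → ℝ)
    (ht : t = fun τ =>
      Real.exp (-1 / (1 - τ)) / (Real.exp (-1 / (1 - τ)) + Real.exp (-1 / τ)))
    (τ : ℝ) (hτ : τ ∈ Set.Ioo (0 : ℝ) (1 / 2)) (c : ℝ) (hc : 9 ≤ c) :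
    1 - t τ - (1 / c) * |deriv t τ| ≥ -2 * Real.exp (-Real.sqrt (c / 2)) := by
  obtain ⟨h0, h1⟩ := hτ
  have hτ0 : τ ≠ 0 := h0.ne'
  have h1' : 0 < 1 - τ := by linarith
  have hτ1 : 1 - τ ≠ 0 := h1'.ne'
  set A := Real.exp (-1 / (1 - τ)) with hA
  set B := Real.exp (-1 / τ) with hB
  have hA0 : 0 < A := Real.exp_pos _
  have hB0 : 0 < B := Real.exp_pos _
  have hAB : A + B ≠ 0 := by positivity
  set u := 1 / τ with hu
  set v := 1 / (1 - τ) with hv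
  have htv : t τ = A / (A + B) := by rw [ht]
  have dA : HasDerivAt (fun x : ℝ => Real.exp (-1 / (1 - x))) (A * (-v ^ 2)) τ := by
    have := (((hasDerivAt_const τ (-1 : ℝ)).div ((hasDerivAt_id τ).const_sub 1) hτ1)).exp
    refine this.congr_deriv ?_
    symm
    change _ = A * ((0 * (1 - τ) - -1 * -1) / (1 - τ) ^ 2)
    rw [hv]
    field_simp
    ring
  have dB : HasDerivAt (fun x : ℝ => Real.exp (-1 / x)) (B * u ^ 2) τ := by
    have := (((hasDerivAt_const τ (-1 : ℝ)).div (hasDerivAt_id τ) hτ0)).exp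
    refine this.congr_deriv ?_
    symm
    change _ = B * ((0 * τ - -1 * 1) / τ ^ 2)
    rw [hu]
    field_simp
    ring
  have dt : HasDerivAt t (-(A * B / (A + B) ^ 2 * (u ^ 2 + v ^ 2))) τ := by
    rw [ht]
    have := dA.div (dA.add dB) hAB
    refine this.congr_deriv ?_
    symm
    change _ = (A * (-v ^ 2) * (A + B) - A * (A * (-v ^ 2) + B * u ^ 2)) / (A + B) ^ 2
    field_simp
    ring
  rw [dt.deriv, htv, abs_neg, abs_of_nonneg (by positivity)]
  have huv : u + v = u * v := by
    rw [hu, hv]; field_simp; ring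
  have hw : 0 < u - v := by
    have : v < u := by
      rw [hu, hv]; apply one_div_lt_one_div_of_lt h0; linarith
    linarith
  have hS : u ^ 2 + v ^ 2 ≤ 8 + 3 / 2 * (u - v) ^ 2 := by
    have := sq_nonneg (u * v - 4)
    have h2 : (u + v) ^ 2 = (u * v) ^ 2 := by rw [huv]
    nlinarith
  set s := Real.sqrt (c / 2) with hs
  have hss : s ^ 2 = c / 2 := Real.sq_sqrt (by linarith)
  have hs0 : 0 < s := Real.sqrt_pos.mpr (by linarith)
  have key := cutoff_aux_exp (u - v) s hw hs0 (by linarith)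
  have hBA : B * Real.exp (u - v) = A := by
    rw [hB, hA, ← Real.exp_add]; congr 1; rw [hu, hv]; ring
  have hE : Real.exp (u - v - s) = Real.exp (u - v) * Real.exp (-s) := by
    rw [← Real.exp_add]; congr 1
  have hc0 : 0 < c := by linarith
  set S := u ^ 2 + v ^ 2 with hSdef
  set F := Real.exp (-s) with hF
  have hF0 : 0 < F := Real.exp_pos _
  have k1 : S ≤ c + 2 * c * (Real.exp (u - v) * F) := by
    rw [hE, hss] at key; linarith
  have k2 : B * S ≤ c * B + 2 * c * (A * F) := by
    calc B * S ≤ B * (c + 2 * c * (Real.exp (u - v) * F)) := by gcongr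
      _ = c * B + 2 * c * ((B * Real.exp (u - v)) * F) := by ring
      _ = _ := by rw [hBA]
  have k3 : A * B * S ≤ c * B * (A + B) + 2 * c * F * (A + B) ^ 2 := by
    have := mul_le_mul_of_nonneg_left k2 hA0.le
    have : 0 ≤ c * B ^ 2 := by positivity
    have : 0 ≤ c * F * (2 * A * B + B ^ 2) := by positivity
    nlinarith
  have e : 1 - A / (A + B) - 1 / c * (A * B / (A + B) ^ 2 * S) - -2 * F
      = (c * B * (A + B) + 2 * c * F * (A + B) ^ 2 - A * B * S) / (c * (A + B) ^ 2) := by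
    field_simp
    ring
  have : 0 ≤ 1 - A / (A + B) - 1 / c * (A * B / (A + B) ^ 2 * S) - -2 * F := by
    rw [e]
    apply div_nonneg <;> [linarith; positivity]
  linarith
end

section
/- Let t : ℝ → ℝ be defined by t(τ) = exp(−1/(1−τ)) / (exp(−1/(1−τ)) + exp(−1/τ)). Then for every τ ∈ (0, 1): −2 ≤ t′(τ) ≤ 0, where t′(τ) denotes the derivative of t at τ. -/
theorem cosh_lower_aux (x : ℝ) : 1 + x ^ 2 / 2 ≤ Real.cosh x := by
  have h : Real.cosh x = 1 + 2 * Real.sinh (x / 2) ^ 2 := by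
    have := Real.cosh_two_mul (x / 2)
    have h2 := Real.cosh_sq (x / 2)
    rw [show 2 * (x / 2) = x by ring] at this
    linarith
  have h3 : (x / 2) ^ 2 ≤ Real.sinh (x / 2) ^ 2 := by
    rcases le_total 0 (x / 2) with h0 | h0
    · have := Real.self_le_sinh_iff.2 h0
      nlinarith
    · have := Real.sinh_le_self_iff.2 h0
      nlinarith
  rw [h]
  nlinarith

/-- Appendix E.2: the derivative of the smooth cutoff
`t(τ) = e^{−1/(1−τ)} / (e^{−1/(1−τ)} + e^{−1/τ})` satisfies `−2 ≤ t′(τ) ≤ 0`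
for all `τ ∈ (0, 1)`. -/
theorem cutoff_deriv_bounds
    (t : ℝ → ℝ)
    (ht : t = fun τ =>
      Real.exp (-1 / (1 - τ)) / (Real.exp (-1 / (1 - τ)) + Real.exp (-1 / τ)))
    (τ : ℝ) (hτ : τ ∈ Set.Ioo (0 : ℝ) 1) :
    -2 ≤ deriv t τ ∧ deriv t τ ≤ 0 := by
  obtain ⟨h0, h1⟩ := hτ
  have h1' : 0 < 1 - τ := by linarith
  obtain ⟨a, ha⟩ : ∃ a, a = 1 / τ := ⟨_, rfl⟩
  obtain ⟨b, hb⟩ : ∃ b, b = 1 / (1 - τ) := ⟨_, rfl⟩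
  have hab : a + b = a * b := by
    rw [ha, hb]; field_simp; ring
  have hdA : HasDerivAt (fun x : ℝ => Real.exp (-1 / (1 - x))) (Real.exp (-b) * (-b ^ 2)) τ := by
    have h := (((hasDerivAt_const τ (-1 : ℝ)).div
      ((hasDerivAt_id τ).const_sub 1) h1'.ne')).exp
    convert h using 1
    on_goal 1 => rfl
    show _ = Real.exp (-1 / (1 - τ)) * ((0 * (1 - τ) - -1 * -1) / (1 - τ) ^ 2)
    rw [hb, neg_div]
    congr 1
    field_simp
    ring
  have hdB : HasDerivAt (fun x : ℝ => Real.exp (-1 / x)) (Real.exp (-a) * (a ^ 2)) τ := by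
    have h := (((hasDerivAt_const τ (-1 : ℝ)).div (hasDerivAt_id τ) h0.ne')).exp
    convert h using 1
    on_goal 1 => rfl
    show _ = Real.exp (-1 / τ) * ((0 * τ - -1 * 1) / τ ^ 2)
    rw [ha, neg_div]
    congr 1
    field_simp
    ring
  have eA : Real.exp (-1 / (1 - τ)) = Real.exp (-b) := by rw [hb, neg_div]
  have eB : Real.exp (-1 / τ) = Real.exp (-a) := by rw [ha, neg_div]
  have hd := hdA.div (hdA.add hdB) (by simp only [Pi.add_apply]; positivity)
  have hcosh : Real.exp (-b) ^ 2 + Real.exp (-a) ^ 2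
      = 2 * (Real.exp (-b) * Real.exp (-a)) * Real.cosh (a - b) := by
    rw [Real.cosh_eq]
    have e1 : Real.exp (a - b) * Real.exp (-a) = Real.exp (-b) := by
      rw [← Real.exp_add]; congr 1; ring
    have e2 : Real.exp (-(a - b)) * Real.exp (-b) = Real.exp (-a) := by
      rw [← Real.exp_add]; congr 1; ring
    linear_combination (-Real.exp (-b)) * e1 - Real.exp (-a) * e2
  have hder : deriv t τ = -((a ^ 2 + b ^ 2) * (Real.exp (-b) * Real.exp (-a)))
      / (Real.exp (-b) + Real.exp (-a)) ^ 2 := by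
    rw [ht]
    refine hd.deriv.trans ?_
    simp only [Pi.add_apply, eA, eB]
    congr 1
    ring
  have hA := Real.exp_pos (-b)
  have hB := Real.exp_pos (-a)
  rw [hder]
  generalize Real.exp (-b) = A at *
  generalize Real.exp (-a) = B at *
  have hAB := mul_pos hA hB
  constructor
  · rw [le_div_iff₀ (by positivity)]
    have hc := cosh_lower_aux (a - b)
    have key : a ^ 2 + b ^ 2 ≤ 4 + 4 * Real.cosh (a - b) := by
      nlinarith [sq_nonneg (a * b - 4), sq_nonneg (a - b), congrArg (· ^ 2) hab]
    nlinarith [mul_le_mul_of_nonneg_left key hAB.le]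
  · apply div_nonpos_of_nonpos_of_nonneg
    · have : 0 ≤ (a ^ 2 + b ^ 2) * (A * B) := by positivity
      linarith
    · positivity
end

section
/- Let t : ℝ → ℝ be defined by t(τ) = exp(−1/(1−τ)) / (exp(−1/(1−τ)) + exp(−1/τ)). Then for every τ ∈ (0, 1): |t″(τ)| ≤ 16, where t″(τ) denotes the second derivative of t at τ. -/
theorem aux_cosh (d : ℝ) : 1 + d^2/2 + d^4/24 + d^6/720 ≤ Real.cosh d := by
  have h := sum_le_hasSum (Finset.range 4) (fun i _ => by
    rw [pow_mul]; positivity) (Real.hasSum_cosh d)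
  norm_num [Finset.sum_range_succ, Nat.factorial] at h
  linarith

theorem aux_poly (d : ℝ) (hd : 0 ≤ d) :
    0 ≤ 2/45 * d^5 - 11/12 * d^3 + 7/2 * d^2 - 8 * d + 24 := by
  nlinarith [mul_nonneg hd (sq_nonneg (d^2 - 8)), mul_nonneg hd (sq_nonneg (d^2 - 10)),
    mul_nonneg hd (sq_nonneg (d - 3)), sq_nonneg (d - 2), sq_nonneg (d-1), sq_nonneg (d-3),
    mul_nonneg hd (sq_nonneg (d^2 - 3*d))]

theorem aux_alg (a b w : ℝ) (ha : 0 < a) (hb : 0 < b) (hab : a + b = a * b) (hd : 0 ≤ a - b)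
    (hw0 : 0 ≤ w) (hw1 : w ≤ 1) :
    |w * (a^2 + b^2)^2 - 2 * (a^3 - b^3)| ≤ 16 * (2 + 2 * Real.cosh (a - b)) := by
  have hc := aux_cosh (a - b)
  obtain ⟨d, hdd⟩ : ∃ d, d = a - b := ⟨_, rfl⟩
  obtain ⟨p, hp⟩ : ∃ p, p = a + b := ⟨_, rfl⟩
  have hpd : p^2 = d^2 + 4*p := by
    rw [hdd, hp]; linear_combination (4:ℝ) * (-hab)
  have hp0 : 0 < p := by rw [hp]; positivity
  have hp4 : 4 ≤ p := by nlinarith [sq_nonneg d]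
  have hpu : p ≤ 4 + d^2/4 := by nlinarith
  have e1 : a^2 + b^2 = d^2 + 2*p := by rw [hdd, hp]; linear_combination (-2:ℝ) * hab
  have e2 : 2 * (a^3 - b^3) = 2*d*(d^2+3*p) := by
    rw [hdd, hp]; linear_combination (-6:ℝ) * (a - b) * hab
  rw [← hdd] at hd hc ⊢
  rw [e1, e2]
  have hq := aux_poly d hd
  have hq2 := mul_nonneg hd hq
  have hdp : d * p ≤ d * (4 + d^2/4) := mul_le_mul_of_nonneg_left hpu hd
  have hP : 0 ≤ (d^2+2*p)^2 := by positivity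
  have hwP : w * (d^2+2*p)^2 ≤ (d^2+2*p)^2 := by nlinarith
  have hwP0 : 0 ≤ w * (d^2+2*p)^2 := by positivity
  rw [abs_le]
  constructor
  · have : 0 ≤ 2*d*(d^2+3*p) := by positivity
    have h6 : 0 ≤ d^6 := by positivity
    nlinarith [sq_nonneg (d^2 - 2*d), sq_nonneg (d-1), sq_nonneg (d^2-d)]
  · have key : (d^2+2*p)^2 - 2*d*(d^2+3*p) ≤
        (d^2+2*(4 + d^2/4))^2 - 2*d*(d^2+3*(4 + d^2/4)) := by
      obtain ⟨q, hq⟩ : ∃ q, q = 4 + d^2/4 := ⟨_, rfl⟩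
      rw [← hq] at hpu ⊢
      have : 0 ≤ (q - p) * (4*d^2 + 4*(q+p) - 6*d) :=
        mul_nonneg (by linarith) (by nlinarith [sq_nonneg (d-1)])
      nlinarith
    nlinarith

theorem aux_alg' (a b : ℝ) (ha : 0 < a) (hb : 0 < b) (hab : a + b = a * b) :
    |Real.tanh ((a-b)/2) * (a^2 + b^2)^2 - 2 * (a^3 - b^3)|
      ≤ 16 * (2 + 2 * Real.cosh (a - b)) := by
  have main : ∀ a b : ℝ, 0 < a → 0 < b → a + b = a * b → 0 ≤ a - b →
    |Real.tanh ((a-b)/2) * (a^2 + b^2)^2 - 2 * (a^3 - b^3)|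
      ≤ 16 * (2 + 2 * Real.cosh (a - b)) := by
    intro a b ha hb hab hd
    refine aux_alg a b _ ha hb hab hd ?_ ?_
    · rw [Real.tanh_eq_sinh_div_cosh]
      exact div_nonneg (Real.sinh_nonneg_iff.2 (by linarith)) (Real.cosh_pos _).le
    · rw [Real.tanh_eq_sinh_div_cosh, div_le_one (Real.cosh_pos _)]
      exact (Real.sinh_lt_cosh _).le
  rcases le_total 0 (a - b) with h | h
  · exact main a b ha hb hab h
  · have := main b a hb ha (by linarith) (by linarith)
    rw [show b - a = -(a - b) by ring, Real.cosh_neg, neg_div, Real.tanh_neg, ← abs_neg] at this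
    convert this using 2
    ring

/-- Appendix E.2: the second derivative of the smooth cutoff
`t(τ) = e^{−1/(1−τ)} / (e^{−1/(1−τ)} + e^{−1/τ})` satisfies `|t″(τ)| ≤ 16`
for all `τ ∈ (0, 1)`. -/
theorem cutoff_second_deriv_bound
    (t : ℝ → ℝ)
    (ht : t = fun τ =>
      Real.exp (-1 / (1 - τ)) / (Real.exp (-1 / (1 - τ)) + Real.exp (-1 / τ)))
    (τ : ℝ) (hτ : τ ∈ Set.Ioo (0 : ℝ) 1) :
    |deriv (deriv t) τ| ≤ 16 := by
  have ht2 : t = fun τ => (1 + Real.exp ((1 - τ)⁻¹ - τ⁻¹))⁻¹ := by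
    rw [ht]; funext x
    have : Real.exp (-1 / x) = Real.exp (-1 / (1 - x)) * Real.exp ((1 - x)⁻¹ - x⁻¹) := by
      rw [← Real.exp_add]; congr 1; ring
    rw [this]
    have := Real.exp_pos (-1 / (1 - x))
    have := Real.exp_pos ((1 - x)⁻¹ - x⁻¹)
    field_simp
  have hE : ∀ x ∈ Set.Ioo (0:ℝ) 1, HasDerivAt (fun x : ℝ => Real.exp ((1 - x)⁻¹ - x⁻¹))
      (Real.exp ((1 - x)⁻¹ - x⁻¹) * (((1 - x)⁻¹)^2 + (x⁻¹)^2)) x := by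
    intro x hx
    have h1 : (1 - x) ≠ 0 := by linarith [hx.2]
    have h0 : x ≠ 0 := hx.1.ne'
    have := ((((hasDerivAt_id x).const_sub 1).inv h1).sub ((hasDerivAt_id x).inv h0)).exp
    refine HasDerivAt.congr_deriv (f := fun x : ℝ => Real.exp ((1 - x)⁻¹ - x⁻¹)) this ?_
    change Real.exp ((1 - x)⁻¹ - x⁻¹) * (- -1 / (1 - x) ^ 2 - -1 / x ^ 2) = _
    field_simp
    ring
  have hd1 : ∀ x ∈ Set.Ioo (0:ℝ) 1, HasDerivAt t
      (-(Real.exp ((1 - x)⁻¹ - x⁻¹) * (((1 - x)⁻¹)^2 + (x⁻¹)^2)) /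
        (1 + Real.exp ((1 - x)⁻¹ - x⁻¹))^2) x := by
    intro x hx
    rw [ht2]
    exact ((hE x hx).const_add 1).inv (by positivity)
  have hev : deriv t =ᶠ[nhds τ] fun x =>
      (-(Real.exp ((1 - x)⁻¹ - x⁻¹) * (((1 - x)⁻¹)^2 + (x⁻¹)^2)) /
        (1 + Real.exp ((1 - x)⁻¹ - x⁻¹))^2) := by
    filter_upwards [isOpen_Ioo.mem_nhds hτ] with x hx using (hd1 x hx).deriv
  rw [hev.deriv_eq]
  have h1 : (1 - τ) ≠ 0 := by linarith [hτ.2]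
  have h0 : τ ≠ 0 := hτ.1.ne'
  have hU : HasDerivAt (fun x : ℝ => ((1 - x)⁻¹)^2 + (x⁻¹)^2)
      (2 * (((1-τ)⁻¹)^3 - (τ⁻¹)^3)) τ := by
    have := ((((hasDerivAt_id τ).const_sub 1).inv h1).pow 2).add (((hasDerivAt_id τ).inv h0).pow 2)
    refine HasDerivAt.congr_deriv (f := fun x : ℝ => ((1 - x)⁻¹)^2 + (x⁻¹)^2) this ?_
    change ((2:ℕ):ℝ) * ((1 - τ)⁻¹)^1 * (- -1 / (1 - τ) ^ 2) + ((2:ℕ):ℝ) * (τ⁻¹)^1 * (-1 / τ ^ 2) = _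
    push_cast
    field_simp
    ring
  have h2 := (((hE τ hτ).mul hU).neg).div (((hE τ hτ).const_add 1).pow 2)
    (pow_ne_zero 2 (by positivity : (1 + Real.exp ((1 - τ)⁻¹ - τ⁻¹)) ≠ 0))
  have h3 := h2.deriv
  refine (congrArg abs h3).trans_le ?_
  have ha : 0 < (1-τ)⁻¹ := inv_pos.2 (by linarith [hτ.2])
  have hb : 0 < τ⁻¹ := inv_pos.2 hτ.1
  have hab : (1-τ)⁻¹ + τ⁻¹ = (1-τ)⁻¹ * τ⁻¹ := by field_simp; ring
  simp only [Pi.mul_apply, Pi.neg_apply, Pi.pow_apply]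
  clear h2 h3 hU hev hd1 hE ht ht2
  generalize (1-τ)⁻¹ = a at *
  generalize τ⁻¹ = b at *
  have hA := aux_alg' a b ha hb hab
  have hth : Real.tanh ((a-b)/2) = (Real.exp (a-b) - 1) / (Real.exp (a-b) + 1) := by
    have hs : Real.exp (a-b) = Real.exp ((a-b)/2) * Real.exp ((a-b)/2) := by
      rw [← Real.exp_add]; congr 1; ring
    rw [Real.tanh_eq_sinh_div_cosh, Real.sinh_eq, Real.cosh_eq, Real.exp_neg, hs]
    have := Real.exp_pos ((a-b)/2)
    field_simp
  have hch : 2 + 2 * Real.cosh (a-b) = (Real.exp (a-b) + 1)^2 / Real.exp (a-b) := by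
    rw [Real.cosh_eq, Real.exp_neg]
    have := Real.exp_pos (a-b)
    field_simp
    ring
  rw [hth, hch] at hA
  have hEp := Real.exp_pos (a-b)
  generalize Real.exp (a-b) = E at *
  have hk : 0 < E / (E+1)^2 := by positivity
  have := mul_le_mul_of_nonneg_left hA hk.le
  rw [← abs_of_pos hk, ← abs_mul, abs_of_pos hk] at this
  have hr : E / (E + 1) ^ 2 * (16 * ((E + 1) ^ 2 / E)) = 16 := by field_simp
  rw [hr] at this
  refine le_of_eq_of_le (congrArg abs ?_) this
  have hne : (1 + E) ≠ 0 := by positivity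
  rw [add_comm E 1]
  norm_num
  field_simp
  ring
end

section
/- Let ℍ be the hyperbolic plane, realized as the upper half-plane with its hyperbolic metric. For every point z₀ ∈ ℍ and every real r ≥ 4, there exist a natural number N with N ≥ exp(r/4) and points z₁, …, z_N in the closed ball of radius (3/4)·r around z₀ such that dist(zᵢ, zⱼ) ≥ r/2 for all i ≠ j. -/
open Metric

theorem cosh_dist_re_im (z w : UpperHalfPlane) :
    Real.cosh (dist z w) = 1 + ((z.re - w.re) ^ 2 + (z.im - w.im) ^ 2) / (2 * z.im * w.im) := by
  rw [UpperHalfPlane.cosh_dist, Complex.dist_eq, Complex.sq_norm, Complex.normSq_apply]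
  simp only [Complex.sub_re, Complex.sub_im, UpperHalfPlane.coe_re, UpperHalfPlane.coe_im]
  ring

/-- Ball-packing property of the hyperbolic plane (Lemma 2.7 specialized to `d = 2`,
curvature `−1`): every closed ball of radius `(3/4)r` in the upper half-plane with
`r ≥ 4` contains at least `e^{r/4}` points that are pairwise at distance `≥ r/2`. -/
theorem hyperbolic_plane_ball_packing (z₀ : UpperHalfPlane) (r : ℝ) (hr : 4 ≤ r) :
    ∃ (N : ℕ) (z : Fin N → UpperHalfPlane),
      (N : ℝ) ≥ Real.exp (r / 4) ∧
      (∀ i, z i ∈ closedBall z₀ (3 / 4 * r)) ∧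
      ∀ i j, i ≠ j → dist (z i) (z j) ≥ r / 2 := by
  obtain ⟨t, rfl⟩ : ∃ t, r = 4 * t := ⟨r / 4, by ring⟩
  have ht : 0 < t := by linarith
  have e1 : 4 * t / 4 = t := by ring
  have e2 : 3 / 4 * (4 * t) = 3 * t := by ring
  have e3 : 4 * t / 2 = 2 * t := by ring
  rw [e1, e2, e3]
  have hy := z₀.im_pos
  have hC : 0 < Real.cosh (3 * t) := Real.cosh_pos _
  have hS : 0 < Real.sinh t := Real.sinh_pos_iff.2 ht
  set h : ℝ := z₀.im / Real.cosh (3 * t) with hh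
  have hpos : 0 < h := div_pos hy hC
  have key : 2 * Real.exp t * Real.sinh t ≤ Real.sinh (3 * t) := by
    rw [Real.sinh_three_mul]
    have h1 : Real.exp t = Real.cosh t + Real.sinh t := (Real.cosh_add_sinh t).symm
    have h2 := Real.cosh_sq t
    have : 2 * Real.exp t ≤ 4 * Real.sinh t ^ 2 + 3 := by
      rw [h1]
      nlinarith [sq_nonneg (Real.cosh t - 1), sq_nonneg (2 * Real.sinh t - 1), sq_nonneg (Real.sinh t - 1)]
    nlinarith
  refine ⟨⌈Real.exp t⌉₊, fun k => UpperHalfPlane.mk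
    ⟨z₀.re + (k : ℕ) * (2 * h * Real.sinh t), h⟩ hpos, Nat.le_ceil _, ?_, ?_⟩
  · intro k
    rw [mem_closedBall, ← abs_of_nonneg (dist_nonneg (α := UpperHalfPlane)),
      ← abs_of_nonneg (by positivity : 0 ≤ 3 * t), ← Real.cosh_le_cosh, cosh_dist_re_im]
    have hk : ((k : ℕ) : ℝ) ≤ Real.exp t := (Nat.lt_ceil.1 k.2).le
    have hk2 : 2 * ((k : ℕ) : ℝ) * Real.sinh t ≤ Real.sinh (3 * t) := by
      refine le_trans ?_ key
      gcongr
    have hk3 : (2 * ((k : ℕ) : ℝ) * Real.sinh t) ^ 2 ≤ Real.cosh (3 * t) ^ 2 - 1 := by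
      rw [Real.cosh_sq, add_sub_cancel_right]
      gcongr
    have hz : z₀.im = h * Real.cosh (3 * t) := by rw [hh]; field_simp
    change 1 + ((z₀.re + (k : ℕ) * (2 * h * Real.sinh t) - z₀.re) ^ 2 + (h - z₀.im) ^ 2)
      / (2 * h * z₀.im) ≤ _
    rw [← le_sub_iff_add_le', div_le_iff₀ (by positivity), hz]
    nlinarith [mul_le_mul_of_nonneg_left hk3 (sq_nonneg h)]
  · intro i j hij
    rw [ge_iff_le, ← abs_of_nonneg (dist_nonneg (α := UpperHalfPlane)),
      ← abs_of_nonneg (by positivity : 0 ≤ 2 * t), ← Real.cosh_le_cosh, cosh_dist_re_im]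
    change _ ≤ 1 + ((z₀.re + (i : ℕ) * (2 * h * Real.sinh t) -
      (z₀.re + (j : ℕ) * (2 * h * Real.sinh t))) ^ 2 + (h - h) ^ 2) / (2 * h * h)
    have hz : (1 : ℝ) ≤ (((i : ℕ) : ℝ) - ((j : ℕ) : ℝ)) ^ 2 := by
      have h0 : ((i : ℕ) : ℤ) - ((j : ℕ) : ℤ) ≠ 0 := by
        intro h; apply hij; ext; omega
      have : (1 : ℤ) ≤ (((i : ℕ) : ℤ) - ((j : ℕ) : ℤ)) ^ 2 := by
        have := sq_pos_of_ne_zero h0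
        omega
      exact_mod_cast this
    have : (z₀.re + (i : ℕ) * (2 * h * Real.sinh t) -
      (z₀.re + (j : ℕ) * (2 * h * Real.sinh t))) ^ 2 + (h - h) ^ 2 =
      (2 * (((i : ℕ) : ℝ) - ((j : ℕ) : ℝ)) ^ 2 * Real.sinh t ^ 2) * (2 * h * h) := by ring
    rw [this, mul_div_cancel_right₀ _ (by positivity), Real.cosh_two_mul, Real.cosh_sq]
    nlinarith [mul_le_mul_of_nonneg_right hz (sq_nonneg (Real.sinh t))]
end

section
/- For every real R > 0 and every t ∈ [0, R): t · exp(t²/(t² − R²)) · (2R²/(R² − t²)²) ≤ (1/R) · sqrt(36 + 21·sqrt 3) · exp(−1/2 − sqrt 3 / 2). (The maximum of the left-hand side over t ∈ [0, R) is attained at t = R/3^{1/4}.) -/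
theorem bump_aux (v : ℝ) (hv : 0 ≤ v) :
    4 * v * (1 + v) ^ 3 * Real.exp (-v) ^ 2 ≤
      (36 + 21 * Real.sqrt 3) * Real.exp (-1 / 2 - Real.sqrt 3 / 2) ^ 2 := by
  set s := Real.sqrt 3 with hs
  have h3 : s ^ 2 = 3 := Real.sq_sqrt (by norm_num)
  have hs0 : 0 ≤ s := Real.sqrt_nonneg 3
  have hs1 : s ≤ 3 := by nlinarith
  have h1 : v * (s - 1) ≤ Real.exp (v * (s - 1) - 1) := by
    linarith [Real.add_one_le_exp (v * (s - 1) - 1)]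
  have h2 : (1 + v) * ((3 - s) / 3) ≤ Real.exp ((1 + v) * ((3 - s) / 3) - 1) := by
    linarith [Real.add_one_le_exp ((1 + v) * ((3 - s) / 3) - 1)]
  have hb : 0 ≤ (1 + v) * ((3 - s) / 3) := mul_nonneg (by linarith) (by linarith)
  have h4 := mul_le_mul h1 (pow_le_pow_left₀ hb h2 3) (by positivity) (by positivity)
  have h5 : 4 * v * (1 + v) ^ 3
      = (36 + 21 * s) * (v * (s - 1) * ((1 + v) * ((3 - s) / 3)) ^ 3) := by
    have : (36 + 21 * s) * ((s - 1) * ((3 - s) / 3) ^ 3) = 4 := by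
      have e3 : s ^ 3 = 3 * s := by rw [pow_succ, h3]
      have e4 : s ^ 4 = 9 := by rw [show s ^ 4 = (s ^ 2) ^ 2 by ring, h3]; norm_num
      have e5 : s ^ 5 = 9 * s := by rw [pow_succ, e4]
      ring_nf
      rw [h3, e3, e4, e5]
      ring
    linear_combination (-v * (1 + v) ^ 3) * this
  have h6 : Real.exp (v * (s - 1) - 1) * Real.exp ((1 + v) * ((3 - s) / 3) - 1) ^ 3
      * Real.exp (-v) ^ 2 = Real.exp (-1 / 2 - s / 2) ^ 2 := by
    rw [← Real.exp_nat_mul, ← Real.exp_nat_mul, ← Real.exp_nat_mul, ← Real.exp_add,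
      ← Real.exp_add]
    congr 1
    push_cast
    ring
  rw [h5, ← h6, mul_assoc]
  gcongr

/-- Optimization bound from Appendix C.1.2: for `0 ≤ t < R`,
`t·e^{t²/(t²−R²)}·2R²/(R²−t²)² ≤ (1/R)·√(36+21√3)·e^{−1/2−√3/2}`
(the maximum over `t` is attained at `t = R/3^{1/4}`). -/
theorem bump_gradient_bound (R t : ℝ) (hR : 0 < R) (ht : t ∈ Set.Ico (0 : ℝ) R) :
    t * Real.exp (t ^ 2 / (t ^ 2 - R ^ 2)) * (2 * R ^ 2 / (R ^ 2 - t ^ 2) ^ 2) ≤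
      (1 / R) * Real.sqrt (36 + 21 * Real.sqrt 3) *
        Real.exp (-1 / 2 - Real.sqrt 3 / 2) := by
  obtain ⟨h0, h1⟩ := ht
  have hD : 0 < R ^ 2 - t ^ 2 := by nlinarith
  have h := bump_aux (t ^ 2 / (R ^ 2 - t ^ 2)) (by positivity)
  have e : t ^ 2 / (t ^ 2 - R ^ 2) = -(t ^ 2 / (R ^ 2 - t ^ 2)) := by
    rw [← div_neg, neg_sub]
  rw [e]
  have e1 : 1 + t ^ 2 / (R ^ 2 - t ^ 2) = R ^ 2 / (R ^ 2 - t ^ 2) := by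
    field_simp
    ring
  rw [e1] at h
  generalize Real.exp (-(t ^ 2 / (R ^ 2 - t ^ 2))) = E at h ⊢
  have hq : 0 ≤ 36 + 21 * Real.sqrt 3 := by positivity
  refine le_of_abs_le (abs_le_of_sq_le_sq ?_ (by positivity))
  rw [mul_pow _ (Real.exp _), mul_pow (1 / R), Real.sq_sqrt hq, mul_assoc ((1 / R) ^ 2)]
  refine le_trans (le_of_eq ?_) (mul_le_mul_of_nonneg_left h (by positivity))
  generalize R ^ 2 - t ^ 2 = D at hD
  field_simp
  try ring
end

section
/- For every real R > 0 and every t ∈ [0, R): (a) exp(t²/(t² − R²)) / (R² − t²)⁴ ≤ 256·exp(−3)/R⁸, and (b) exp(t²/(t² − R²)) / (R² − t²)² ≤ 4·exp(−1)/R⁴. -/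
/-- Optimization bounds from Appendix C.1.3: for `0 ≤ t < R`,
`e^{t²/(t²−R²)}/(R²−t²)⁴ ≤ 256·e⁻³/R⁸` and `e^{t²/(t²−R²)}/(R²−t²)² ≤ 4·e⁻¹/R⁴`. -/
theorem bump_hessian_bounds (R t : ℝ) (hR : 0 < R) (ht : t ∈ Set.Ico (0 : ℝ) R) :
    Real.exp (t ^ 2 / (t ^ 2 - R ^ 2)) / (R ^ 2 - t ^ 2) ^ 4 ≤
        256 * Real.exp (-3) / R ^ 8 ∧
      Real.exp (t ^ 2 / (t ^ 2 - R ^ 2)) / (R ^ 2 - t ^ 2) ^ 2 ≤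
        4 * Real.exp (-1) / R ^ 4 := by
  have hD : 0 < R ^ 2 - t ^ 2 := by nlinarith [ht.1, ht.2]
  have hE : t ^ 2 - R ^ 2 ≠ 0 := by linarith
  obtain ⟨s, hs⟩ : ∃ s, s = R ^ 2 / (R ^ 2 - t ^ 2) := ⟨_, rfl⟩
  have hs0 : 0 < s := by rw [hs]; positivity
  have hsD : s * (R ^ 2 - t ^ 2) = R ^ 2 := by rw [hs]; field_simp
  have he : t ^ 2 / (t ^ 2 - R ^ 2) = 1 - s := by
    rw [div_eq_iff hE]; linarith
  rw [he]
  constructor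
  · have h1 : s / 4 ≤ Real.exp (s / 4 - 1) := by
      linarith [Real.add_one_le_exp (s / 4 - 1)]
    have h2 : s ^ 4 ≤ 256 * Real.exp (s - 4) := by
      have h3 := pow_le_pow_left₀ (by positivity) h1 4
      rw [← Real.exp_nat_mul] at h3
      have h4 : ((4 : ℕ) : ℝ) * (s / 4 - 1) = s - 4 := by push_cast; ring
      rw [h4] at h3
      linarith [div_pow s 4 4]
    have h5 : Real.exp (1 - s) * Real.exp (s - 4) = Real.exp (-3) := by
      rw [← Real.exp_add]; congr 1; ring
    have h6 : R ^ 8 = s ^ 4 * (R ^ 2 - t ^ 2) ^ 4 := by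
      rw [← mul_pow, hsD]; ring
    rw [div_le_div_iff₀ (by positivity) (by positivity), h6, ← h5]
    have := mul_le_mul_of_nonneg_left h2
      (by positivity : 0 ≤ Real.exp (1 - s) * (R ^ 2 - t ^ 2) ^ 4)
    linarith
  · have h1 : s / 2 ≤ Real.exp (s / 2 - 1) := by
      linarith [Real.add_one_le_exp (s / 2 - 1)]
    have h2 : s ^ 2 ≤ 4 * Real.exp (s - 2) := by
      have h3 := pow_le_pow_left₀ (by positivity) h1 2
      rw [← Real.exp_nat_mul] at h3
      have h4 : ((2 : ℕ) : ℝ) * (s / 2 - 1) = s - 2 := by push_cast; ring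
      rw [h4] at h3
      linarith [div_pow s 2 2]
    have h5 : Real.exp (1 - s) * Real.exp (s - 2) = Real.exp (-1) := by
      rw [← Real.exp_add]; congr 1; ring
    have h6 : R ^ 4 = s ^ 2 * (R ^ 2 - t ^ 2) ^ 2 := by
      rw [← mul_pow, hsD]; ring
    rw [div_le_div_iff₀ (by positivity) (by positivity), h6, ← h5]
    have := mul_le_mul_of_nonneg_left h2
      (by positivity : 0 ≤ Real.exp (1 - s) * (R ^ 2 - t ^ 2) ^ 2)
    linarith
end
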